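/- Let c > 0, c ≠ 1, h(0) > 0, λ = i·log(c)/π, and define E(z) = ( 2·log(c)/(h(0)·(c²−1)) )^{1/2} · G(λ; 2πiz) (note 2·log(c)/(c²−1) > 0 for c ≠ 1). Then E belongs to the Hermite–Biehler class, and for all real x ≠ y the limiting kernel K_∞(x,y) = (1/(h(0)·πi))·(log c/(c²−1))·[G(1+λ; 2πix)·G(λ; 2πiy) − G(1+λ; 2πiy)·G(λ; 2πix)]/(x−y) coincides with the de Branges reproducing kernel of E: K_∞(x,y) = (i/(2π))·( E(x)·conj(E(y)) − conj(E(x))·E(y) )/(x − y). -/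

import Mathlib

open Filter Set

/-- `G(a;ζ) = e^{-ζ/2} ∑_{k≥0} ((a)_k/(k!)²) ζ^k`, where `(a)_k` is the Pochhammer symbol. -/
noncomputable def Gfun (a ζ : ℂ) : ℂ :=
  Complex.exp (-ζ / 2) *
    ∑' k : ℕ, ((ascPochhammer ℂ k).eval a / ((Nat.factorial k : ℂ)) ^ 2) * ζ ^ k

/-- `λ = i·log(c)/π`. -/
noncomputable def lamC (c : ℝ) : ℂ := Complex.I * ((Real.log c / Real.pi : ℝ) : ℂ)

/-- `E(z) = (2·log(c)/(h(0)·(c²−1)))^{1/2} · G(λ; 2πiz)`. -/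
noncomputable def Efun (c h0 : ℝ) (z : ℂ) : ℂ :=
  (Real.sqrt (2 * Real.log c / (h0 * (c ^ 2 - 1))) : ℂ) *
    Gfun (lamC c) (2 * (Real.pi : ℂ) * Complex.I * z)

/-- The Chu–Vandermonde identity behind Kummer's transformation. -/
theorem sum_antidiagonal_choose_mul_ascPochhammer (a : ℂ) (n : ℕ) :
    ∑ p ∈ Finset.HasAntidiagonal.antidiagonal n, (n.choose p.1 : ℂ) *
      ((-1) ^ p.2 * (ascPochhammer ℂ p.2).eval a / (p.2.factorial : ℂ)) =
      (ascPochhammer ℂ n).eval (1 - a) / (n.factorial : ℂ) := by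
  have hchoose (r : ℂ) (j : ℕ) :
      Ring.choose r j = (ascPochhammer ℂ j).eval (r - j + 1) / (j.factorial : ℂ) := by
    rw [Ring.choose_eq_smul, Polynomial.descPochhammer_smeval_eq_ascPochhammer,
      Polynomial.ascPochhammer_smeval_cast, Polynomial.ascPochhammer_smeval_eq_eval, smul_eq_mul,
      div_eq_inv_mul]
  have hneg (j : ℕ) : Ring.choose (-a) j =
      (-1) ^ j * (ascPochhammer ℂ j).eval a / (j.factorial : ℂ) := by
    rw [hchoose, ← descPochhammer_eval_eq_ascPochhammer]
    have h := ascPochhammer_eval_neg_eq_descPochhammer ℂ (-a) j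
    rw [neg_neg] at h
    rw [h, ← mul_assoc, ← mul_pow]
    simp
  have h := Ring.add_choose_eq n (Commute.all (n : ℂ) (-a))
  rw [hchoose, show (n : ℂ) + -a - n + 1 = 1 - a by ring] at h
  rw [h]
  refine Finset.sum_congr rfl fun p _ => ?_
  rw [Ring.choose_natCast, hneg]

theorem summable_norm_kummer (a ζ : ℂ) :
    Summable fun k : ℕ =>
      ‖((ascPochhammer ℂ k).eval a / ((Nat.factorial k : ℂ)) ^ 2) * ζ ^ k‖ := by
  refine summable_of_ratio_norm_eventually_le (r := 1 / 2) (by norm_num) ?_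
  obtain ⟨N, hN⟩ := exists_nat_ge (2 * (‖a‖ + 1) * ‖ζ‖)
  filter_upwards [eventually_ge_atTop N] with k hk
  have hratio : ‖(a + k) / ((k : ℂ) + 1) ^ 2 * ζ‖ ≤ 1 / 2 := by
    have hnorm : ‖(k : ℂ) + 1‖ = (k : ℝ) + 1 := by
      have := Complex.norm_natCast (k + 1)
      push_cast at this
      exact this
    rw [norm_mul, norm_div, norm_pow, hnorm, div_mul_eq_mul_div, div_le_div_iff₀ (by positivity)
      two_pos]
    have h1 : ‖a + k‖ ≤ (‖a‖ + 1) * (k + 1) := by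
      refine (norm_add_le _ _).trans ?_
      rw [Complex.norm_natCast]
      nlinarith [norm_nonneg a, mul_nonneg (norm_nonneg a) (Nat.cast_nonneg (α := ℝ) k)]
    have h2 : 2 * (‖a‖ + 1) * ‖ζ‖ ≤ k + 1 := hN.trans (by
      have : (N : ℝ) ≤ k := by exact_mod_cast hk
      linarith)
    calc ‖a + k‖ * ‖ζ‖ * 2 ≤ (‖a‖ + 1) * (k + 1) * ‖ζ‖ * 2 := by gcongr
      _ = (2 * (‖a‖ + 1) * ‖ζ‖) * (k + 1) := by ring
      _ ≤ (k + 1) * (k + 1) := by gcongr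
      _ = 1 * ((k : ℝ) + 1) ^ 2 := by ring
  have hstep : ((ascPochhammer ℂ (k + 1)).eval a / (((k + 1).factorial : ℂ)) ^ 2) * ζ ^ (k + 1) =
      ((a + k) / ((k : ℂ) + 1) ^ 2 * ζ) *
        (((ascPochhammer ℂ k).eval a / ((Nat.factorial k : ℂ)) ^ 2) * ζ ^ k) := by
    have : (k : ℂ) + 1 ≠ 0 := by exact_mod_cast k.succ_ne_zero
    have : (k.factorial : ℂ) ≠ 0 := by exact_mod_cast k.factorial_ne_zero
    rw [ascPochhammer_succ_eval, Nat.factorial_succ, pow_succ ζ]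
    push_cast
    field_simp
  rw [norm_norm, norm_norm, hstep, norm_mul]
  gcongr

theorem summable_kummer (a ζ : ℂ) :
    Summable fun k : ℕ =>
      ((ascPochhammer ℂ k).eval a / ((Nat.factorial k : ℂ)) ^ 2) * ζ ^ k :=
  (summable_norm_kummer a ζ).of_norm

/-- Kummer's transformation. -/
theorem Gfun_one_sub_neg (a ζ : ℂ) : Gfun (1 - a) (-ζ) = Gfun a ζ := by
  have hexp : Complex.exp (-ζ) = ∑' k : ℕ, (-ζ) ^ k / (k.factorial : ℂ) := by
    rw [Complex.exp_eq_exp_ℂ]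
    exact (NormedSpace.expSeries_div_hasSum_exp (-ζ)).tsum_eq.symm
  have key : Complex.exp (-ζ) *
      ∑' k : ℕ, ((ascPochhammer ℂ k).eval a / ((Nat.factorial k : ℂ)) ^ 2) * ζ ^ k =
      ∑' k : ℕ, ((ascPochhammer ℂ k).eval (1 - a) / ((Nat.factorial k : ℂ)) ^ 2) * (-ζ) ^ k := by
    rw [hexp, tsum_mul_tsum_eq_tsum_sum_antidiagonal_of_summable_norm
      (NormedSpace.norm_expSeries_div_summable (-ζ)) (summable_norm_kummer a ζ)]
    refine tsum_congr fun n => ?_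
    have hn : (n.factorial : ℂ) ≠ 0 := by exact_mod_cast n.factorial_ne_zero
    rw [show (ascPochhammer ℂ n).eval (1 - a) / ((Nat.factorial n : ℂ)) ^ 2 * (-ζ) ^ n =
        ((ascPochhammer ℂ n).eval (1 - a) / (n.factorial : ℂ)) * ((-ζ) ^ n / n.factorial) by
          field_simp,
      ← sum_antidiagonal_choose_mul_ascPochhammer, Finset.sum_mul]
    refine Finset.sum_congr rfl fun p hp => ?_
    obtain ⟨i, j⟩ := p
    obtain rfl : i + j = n := Finset.HasAntidiagonal.mem_antidiagonal.mp hp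
    have hi : (i.factorial : ℂ) ≠ 0 := by exact_mod_cast i.factorial_ne_zero
    have hj : (j.factorial : ℂ) ≠ 0 := by exact_mod_cast j.factorial_ne_zero
    have hsign : ζ ^ j = (-1) ^ j * (-ζ) ^ j := by rw [← mul_pow]; simp
    dsimp only
    rw [Nat.cast_add_choose ℂ, pow_add, hsign]
    field_simp
  rw [Gfun, Gfun, ← key, ← mul_assoc, ← Complex.exp_add]
  congr 2
  ring

theorem conj_Gfun (a ζ : ℂ) :
    (starRingEnd ℂ) (Gfun a ζ) = Gfun ((starRingEnd ℂ) a) ((starRingEnd ℂ) ζ) := by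
  have hpoch (k : ℕ) : (starRingEnd ℂ) ((ascPochhammer ℂ k).eval a) =
      (ascPochhammer ℂ k).eval ((starRingEnd ℂ) a) := by
    induction k with
    | zero => simp
    | succ k ih => simp [ascPochhammer_succ_eval, ih]
  rw [Gfun, Gfun, map_mul, ← Complex.exp_conj, Complex.conj_tsum]
  simp [hpoch, Complex.conj_ofNat]

theorem Gfun_zero_right (a : ℂ) : Gfun a 0 = 1 := by
  rw [Gfun, tsum_eq_single 0 (fun k hk => by simp [hk])]
  simp

theorem hasDerivAt_kummer (a ζ : ℂ) :
    HasDerivAt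
      (fun z => ∑' k : ℕ, ((ascPochhammer ℂ k).eval a / ((Nat.factorial k : ℂ)) ^ 2) * z ^ k)
      (∑' k : ℕ, ((ascPochhammer ℂ k).eval a / ((Nat.factorial k : ℂ)) ^ 2) *
        (k * ζ ^ (k - 1))) ζ := by
  set R : ℝ := ‖ζ‖ + 1 with hR
  have hR1 : 1 ≤ R := by simp [hR]
  have hζ : ζ ∈ Metric.ball (0 : ℂ) R := by simp [hR]
  refine hasDerivAt_tsum_of_isPreconnected (summable_norm_kummer a (2 * R : ℝ))
    Metric.isOpen_ball (convex_ball _ _).isPreconnected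
    (fun k z _ => (hasDerivAt_pow k z).const_mul _) (fun k z hz => ?_) hζ
    (summable_kummer a ζ) hζ
  have hz' : ‖z‖ ≤ R := by simpa using (Metric.mem_ball.mp hz).le
  rw [norm_mul, norm_mul (_ / _)]
  gcongr
  rw [norm_mul, norm_pow, norm_pow, Complex.norm_natCast, Complex.norm_real, Real.norm_of_nonneg
    (by positivity), mul_pow]
  gcongr
  · exact_mod_cast Nat.lt_two_pow_self.le
  · calc ‖z‖ ^ (k - 1) ≤ R ^ (k - 1) := by gcongr
      _ ≤ R ^ k := pow_le_pow_right₀ hR1 (Nat.sub_le k 1)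

theorem exists_hasDerivAt_Gfun (a ζ : ℂ) :
    ∃ d, HasDerivAt (Gfun a) d ζ ∧
      ζ * d = a * (Gfun (1 + a) ζ - Gfun a ζ) - ζ / 2 * Gfun a ζ := by
  have hexp : HasDerivAt (fun z : ℂ => Complex.exp (-z / 2)) (Complex.exp (-ζ / 2) * (-1 / 2)) ζ :=
    ((hasDerivAt_id ζ).neg.div_const 2).cexp
  refine ⟨_, hexp.mul (hasDerivAt_kummer a ζ), ?_⟩
  have key : ζ * ∑' k : ℕ, ((ascPochhammer ℂ k).eval a / ((Nat.factorial k : ℂ)) ^ 2) *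
        (k * ζ ^ (k - 1)) =
      a * (∑' k : ℕ, ((ascPochhammer ℂ k).eval (1 + a) / ((Nat.factorial k : ℂ)) ^ 2) * ζ ^ k -
        ∑' k : ℕ, ((ascPochhammer ℂ k).eval a / ((Nat.factorial k : ℂ)) ^ 2) * ζ ^ k) := by
    rw [← (summable_kummer (1 + a) ζ).tsum_sub (summable_kummer a ζ), ← tsum_mul_left,
      ← tsum_mul_left]
    refine tsum_congr fun k => ?_
    have hshift : a * (ascPochhammer ℂ k).eval (1 + a) = (ascPochhammer ℂ k).eval a * (a + k) := by
      rw [← ascPochhammer_succ_eval, ascPochhammer_succ_left]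
      simp [add_comm]
    have hpow : ζ * (k * ζ ^ (k - 1)) = k * ζ ^ k := by
      cases k with
      | zero => simp
      | succ k => simp [pow_succ]; ring
    linear_combination ((ascPochhammer ℂ k).eval a / ((Nat.factorial k : ℂ)) ^ 2) * hpow -
      (ζ ^ k / ((Nat.factorial k : ℂ)) ^ 2) * hshift
  simp only [Gfun]
  linear_combination Complex.exp (-ζ / 2) * key

theorem exists_hasDerivAt_Gfun_one_add (a ζ : ℂ) :
    ∃ d, HasDerivAt (Gfun (1 + a)) d ζ ∧
      ζ * d = a * (Gfun (1 + a) ζ - Gfun a ζ) + ζ / 2 * Gfun (1 + a) ζ := by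
  obtain ⟨d, hd, hrel⟩ := exists_hasDerivAt_Gfun (-a) (-ζ)
  have hsymm : Gfun (1 + a) = fun z => Gfun (-a) (-z) := by
    funext z
    rw [← Gfun_one_sub_neg (1 + a) z]
    congr 1
    ring
  refine ⟨-d, ?_, ?_⟩
  · rw [hsymm]
    exact (hd.comp ζ (hasDerivAt_neg ζ)).congr_deriv (mul_neg_one d)
  · have h1 : Gfun (1 + -a) (-ζ) = Gfun a ζ := by
      rw [← Gfun_one_sub_neg a ζ, sub_eq_add_neg]
    have h2 : Gfun (-a) (-ζ) = Gfun (1 + a) ζ := by rw [hsymm]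
    rw [h1, h2] at hrel
    linear_combination hrel

/-- The energy identity for `|G(a;·)|² - |G(1+a;·)|²` along a ray, for imaginary `a`. -/
theorem hasDerivAt_normSq_Gfun_sub {a : ℂ} (ha : a.re = 0) (ζ : ℂ) {r : ℝ} (hr : r ≠ 0) :
    HasDerivAt (fun s : ℝ => ‖Gfun a (s * ζ)‖ ^ 2 - ‖Gfun (1 + a) (s * ζ)‖ ^ 2)
      (-ζ.re * (‖Gfun a (r * ζ)‖ ^ 2 + ‖Gfun (1 + a) (r * ζ)‖ ^ 2)) r := by
  obtain ⟨d, hd, hrel⟩ := exists_hasDerivAt_Gfun a (r * ζ)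
  obtain ⟨e, he, hrel'⟩ := exists_hasDerivAt_Gfun_one_add a (r * ζ)
  have hray : HasDerivAt (fun s : ℝ => (s : ℂ) * ζ) ζ r := by
    simpa using (Complex.ofRealCLM.hasDerivAt (x := r)).mul_const ζ
  have hu := (HasDerivAt.comp r hd hray).norm_sq
  have hv := (HasDerivAt.comp r he hray).norm_sq
  refine (hu.sub hv).congr_deriv ?_
  simp only [Function.comp_apply, Complex.inner]
  set u := Gfun a (r * ζ)
  set v := Gfun (1 + a) (r * ζ)
  apply mul_left_cancel₀ hr
  have h1 := congrArg Complex.re hrel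
  have h2 := congrArg Complex.im hrel
  have h3 := congrArg Complex.re hrel'
  have h4 := congrArg Complex.im hrel'
  have hhalf (w x : ℂ) : w / 2 * x = ((1 / 2 : ℝ) : ℂ) * (w * x) := by push_cast; ring
  rw [hhalf] at h1 h2 h3 h4
  simp only [Complex.mul_re, Complex.mul_im, Complex.add_re, Complex.add_im, Complex.sub_re,
    Complex.sub_im, Complex.ofReal_re, Complex.ofReal_im, ha] at h1 h2 h3 h4
  simp only [← Complex.normSq_eq_norm_sq, Complex.normSq_apply, Complex.mul_re, Complex.mul_im,
    Complex.conj_re, Complex.conj_im]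
  linear_combination 2 * u.re * h1 + 2 * u.im * h2 - 2 * v.re * h3 - 2 * v.im * h4

theorem continuous_Gfun (a : ℂ) : Continuous (Gfun a) :=
  continuous_iff_continuousAt.mpr fun ζ =>
    let ⟨_, hd, _⟩ := exists_hasDerivAt_Gfun a ζ
    hd.continuousAt

theorem monotoneOn_normSq_Gfun_sub {a : ℂ} (ha : a.re = 0) {ζ : ℂ} (hζ : ζ.re < 0) :
    MonotoneOn (fun s : ℝ => ‖Gfun a (s * ζ)‖ ^ 2 - ‖Gfun (1 + a) (s * ζ)‖ ^ 2) (Icc 0 1) := by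
  have hu := continuous_Gfun a
  have hv := continuous_Gfun (1 + a)
  refine monotoneOn_of_deriv_nonneg (convex_Icc 0 1) (by fun_prop) ?_ ?_ <;>
    rw [interior_Icc]
  · exact fun r hr =>
      (hasDerivAt_normSq_Gfun_sub ha ζ hr.1.ne').differentiableAt.differentiableWithinAt
  · intro r hr
    rw [(hasDerivAt_normSq_Gfun_sub ha ζ hr.1.ne').deriv]
    have := neg_pos.mpr hζ
    positivity

theorem norm_Gfun_one_add_le {a : ℂ} (ha : a.re = 0) {ζ : ℂ} (hζ : ζ.re < 0) :
    ‖Gfun (1 + a) ζ‖ ≤ ‖Gfun a ζ‖ := by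
  have h := monotoneOn_normSq_Gfun_sub ha hζ (left_mem_Icc.mpr zero_le_one)
    (right_mem_Icc.mpr zero_le_one) zero_le_one
  simp only [Complex.ofReal_zero, zero_mul, Gfun_zero_right, sub_self, Complex.ofReal_one,
    one_mul, sub_nonneg] at h
  exact le_of_sq_le_sq h (norm_nonneg _)

theorem Gfun_ne_zero {a : ℂ} (ha : a.re = 0) {ζ : ℂ} (hζ : ζ.re < 0) : Gfun a ζ ≠ 0 := by
  intro h0
  have hmono := monotoneOn_normSq_Gfun_sub ha hζ
  set D := fun s : ℝ => ‖Gfun a (s * ζ)‖ ^ 2 - ‖Gfun (1 + a) (s * ζ)‖ ^ 2 with hD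
  have hD0 : D 0 = 0 := by simp [hD, Gfun_zero_right]
  have hD1 : D 1 ≤ 0 := by simp [hD, h0]
  have hDzero : ∀ r ∈ Ioo (0 : ℝ) 1, D r = 0 := fun r hr =>
    le_antisymm
      ((hmono (Ioo_subset_Icc_self hr) (right_mem_Icc.mpr zero_le_one) hr.2.le).trans hD1)
      (hD0.symm.le.trans
        (hmono (left_mem_Icc.mpr zero_le_one) (Ioo_subset_Icc_self hr) hr.1.le))
  have hGzero : EqOn (fun r : ℝ => Gfun a (r * ζ)) (fun _ => 0) (Ioo 0 1) := by
    intro r hr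
    have hderiv : deriv D r = 0 := by
      have : D =ᶠ[nhds r] fun _ => 0 :=
        (isOpen_Ioo.mem_nhds hr |> Filter.eventually_of_mem) hDzero
      rw [this.deriv_eq, deriv_const]
    rw [(hasDerivAt_normSq_Gfun_sub ha ζ hr.1.ne').deriv] at hderiv
    have hsum := (mul_eq_zero.mp hderiv).resolve_left (neg_ne_zero.mpr hζ.ne)
    have hsq : ‖Gfun a (r * ζ)‖ ^ 2 = 0 :=
      ((add_eq_zero_iff_of_nonneg (sq_nonneg _) (sq_nonneg _)).mp hsum).1
    simpa using hsq
  have hcont : Continuous fun r : ℝ => Gfun a (r * ζ) := by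
    have := continuous_Gfun a
    fun_prop
  have hclosure := hGzero.closure hcont continuous_const
  rw [closure_Ioo zero_ne_one] at hclosure
  have := hclosure (left_mem_Icc.mpr zero_le_one)
  simp [Gfun_zero_right] at this

theorem lamC_re (c : ℝ) : (lamC c).re = 0 := by
  simp [lamC, -Complex.ofReal_div]

theorem conj_lamC (c : ℝ) : (starRingEnd ℂ) (lamC c) = -lamC c := by
  simp [lamC]

theorem conj_Gfun_lamC (c : ℝ) (z : ℂ) :
    (starRingEnd ℂ) (Gfun (lamC c) (2 * (Real.pi : ℂ) * Complex.I * (starRingEnd ℂ) z)) =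
      Gfun (1 + lamC c) (2 * (Real.pi : ℂ) * Complex.I * z) := by
  rw [conj_Gfun, conj_lamC, ← Gfun_one_sub_neg (1 + lamC c)]
  simp [Complex.conj_ofNat]

theorem log_div_sq_sub_one_pos {c : ℝ} (hc : 0 < c) (hc1 : c ≠ 1) :
    0 < Real.log c / (c ^ 2 - 1) := by
  rcases lt_or_gt_of_ne hc1 with h | h
  · exact div_pos_of_neg_of_neg (Real.log_neg hc h) (by nlinarith)
  · exact div_pos (Real.log_pos h) (by nlinarith)

theorem stmt19 (c : ℝ) (hc : 0 < c) (hc1 : c ≠ 1) (h0 : ℝ) (hh0 : 0 < h0) :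
    -- the normalizing constant is positive
    0 < 2 * Real.log c / (c ^ 2 - 1) ∧
    -- E belongs to the Hermite–Biehler class
    (∀ z : ℂ, 0 < z.im → Efun c h0 z ≠ 0) ∧
    (∀ z : ℂ, 0 < z.im → ‖Efun c h0 ((starRingEnd ℂ) z)‖ ≤ ‖Efun c h0 z‖) ∧
    -- K_∞ coincides with the de Branges reproducing kernel of E
    (∀ x y : ℝ, x ≠ y →
      (1 / ((h0 : ℂ) * (Real.pi : ℂ) * Complex.I)) * (((Real.log c : ℝ) : ℂ) / ((c : ℂ) ^ 2 - 1)) *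
        ((Gfun (1 + lamC c) (2 * (Real.pi : ℂ) * Complex.I * (x : ℂ)) *
            Gfun (lamC c) (2 * (Real.pi : ℂ) * Complex.I * (y : ℂ)) -
          Gfun (1 + lamC c) (2 * (Real.pi : ℂ) * Complex.I * (y : ℂ)) *
            Gfun (lamC c) (2 * (Real.pi : ℂ) * Complex.I * (x : ℂ))) / ((x : ℂ) - (y : ℂ))) =
      (Complex.I / (2 * (Real.pi : ℂ))) *
        ((Efun c h0 (x : ℂ) * (starRingEnd ℂ) (Efun c h0 (y : ℂ)) -
          (starRingEnd ℂ) (Efun c h0 (x : ℂ)) * Efun c h0 (y : ℂ)) / ((x : ℂ) - (y : ℂ)))) := by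
  have hpos := log_div_sq_sub_one_pos hc hc1
  have hpos' : 0 < 2 * Real.log c / (h0 * (c ^ 2 - 1)) := by
    rw [show 2 * Real.log c / (h0 * (c ^ 2 - 1)) = 2 / h0 * (Real.log c / (c ^ 2 - 1)) by
      rw [mul_div_mul_comm]]
    positivity
  have hre (z : ℂ) (hz : 0 < z.im) : (2 * (Real.pi : ℂ) * Complex.I * z).re < 0 := by
    have : (2 * (Real.pi : ℂ) * Complex.I * z).re = -(2 * Real.pi * z.im) := by simp
    rw [this, neg_lt_zero]
    have := Real.pi_pos
    positivity
  refine ⟨by rw [mul_div_assoc]; positivity, fun z hz => ?_, fun z hz => ?_, fun x y _ => ?_⟩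
  · exact mul_ne_zero (by exact_mod_cast (Real.sqrt_pos.mpr hpos').ne')
      (Gfun_ne_zero (lamC_re c) (hre z hz))
  · rw [Efun, Efun, norm_mul, norm_mul, ← Complex.norm_conj (Gfun _ _), conj_Gfun_lamC]
    gcongr
    exact norm_Gfun_one_add_le (lamC_re c) (hre z hz)
  · have hconj (t : ℝ) := conj_Gfun_lamC c t
    simp only [Complex.conj_ofReal] at hconj
    simp only [Efun, map_mul, Complex.conj_ofReal, hconj]
    have hsq : ((Real.sqrt (2 * Real.log c / (h0 * (c ^ 2 - 1))) : ℝ) : ℂ) ^ 2 =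
        2 * (Real.log c : ℂ) / h0 / ((c : ℂ) ^ 2 - 1) := by
      rw [← Complex.ofReal_pow, Real.sq_sqrt hpos'.le]
      push_cast
      rw [div_div]
    set q := ((Real.sqrt (2 * Real.log c / (h0 * (c ^ 2 - 1))) : ℝ) : ℂ)
    set A := Gfun (lamC c) (2 * (Real.pi : ℂ) * Complex.I * (x : ℂ))
    set B := Gfun (lamC c) (2 * (Real.pi : ℂ) * Complex.I * (y : ℂ))
    set A' := Gfun (1 + lamC c) (2 * (Real.pi : ℂ) * Complex.I * (x : ℂ))
    set B' := Gfun (1 + lamC c) (2 * (Real.pi : ℂ) * Complex.I * (y : ℂ))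
    rw [show q * A * (q * B') - q * A' * (q * B) = q ^ 2 * (A * B' - A' * B) by ring, hsq,
      one_div, mul_inv, Complex.inv_I]
    ring
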